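/- arXiv:2602.05927 — 9 statements merged into one kernel-verified Lean document; each statement's English description precedes it below -/
import Mathlib

section
/- Arc-cosine kernel of degree 1 for ReLU: let X and Z be independent standard Gaussian random variables, let σ > 0 and ρ ∈ [−1, 1], and set U₁ = σ·X and U₂ = σ·(ρ·X + √(1−ρ²)·Z), so that (U₁, U₂) is a centered bivariate Gaussian pair with common variance σ² and correlation ρ. Then the expectation of ReLU(U₁)·ReLU(U₂) equals (σ²/(2π))·(√(1−ρ²) + (π − arccos ρ)·ρ). -/
open MeasureTheory ProbabilityTheory Real

/-- The expectation of a positively homogeneous function of degree 2 of a standard Gaussian pair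
in the plane is `π⁻¹` times its integral over the unit circle. -/
lemma integral_prod_gaussianReal_of_homogeneous (f : ℝ × ℝ → ℝ)
    (hf : ∀ r : ℝ, 0 < r → ∀ p : ℝ × ℝ, f (r * p.1, r * p.2) = r ^ 2 * f p) :
    ∫ p, f p ∂((gaussianReal 0 1).prod (gaussianReal 0 1)) =
      π⁻¹ * ∫ θ in -π..π, f (cos θ, sin θ) := by
  have radial : ∫ r in Set.Ioi (0 : ℝ), r ^ 3 * exp (-(1 / 2) * r ^ 2) = 2 := by
    have h := integral_rpow_mul_exp_neg_mul_rpow (p := 2) (q := 3) (b := 1 / 2)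
      (by norm_num) (by norm_num) (by norm_num)
    have hGamma : Gamma ((3 + 1) / 2) = 1 := by
      rw [show ((3 : ℝ) + 1) / 2 = 2 by norm_num, Gamma_two]
    rw [hGamma, show (-((3 : ℝ) + 1) / 2) = ((-2 : ℤ) : ℝ) by norm_num, rpow_intCast] at h
    norm_num at h
    norm_num
    exact_mod_cast h
  have density (x y : ℝ) : gaussianPDFReal 0 1 x * gaussianPDFReal 0 1 y =
      (2 * π)⁻¹ * exp (-(1 / 2) * (x ^ 2 + y ^ 2)) := by
    simp only [gaussianPDFReal, NNReal.coe_one, mul_one, sub_zero]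
    rw [mul_mul_mul_comm, ← mul_inv, mul_self_sqrt (by positivity), ← exp_add]
    congr 2
    ring
  rw [gaussianReal_of_var_ne_zero _ one_ne_zero,
    prod_withDensity (measurable_gaussianPDF 0 1) (measurable_gaussianPDF 0 1),
    integral_withDensity_eq_integral_toReal_smul (by fun_prop)
      (ae_of_all _ fun _ ↦ ENNReal.mul_lt_top gaussianPDF_lt_top gaussianPDF_lt_top),
    ← Measure.volume_eq_prod, ← integral_comp_polarCoord_symm, polarCoord_target,
    intervalIntegral.integral_of_le (by linarith [pi_pos]), integral_Ioc_eq_integral_Ioo]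
  calc
    _ = ∫ p in Set.Ioi (0 : ℝ) ×ˢ Set.Ioo (-π) π,
        (p.1 ^ 3 * exp (-(1 / 2) * p.1 ^ 2)) * ((2 * π)⁻¹ * f (cos p.2, sin p.2)) := by
      refine setIntegral_congr_fun (measurableSet_Ioi.prod measurableSet_Ioo) fun p hp ↦ ?_
      simp only [polarCoord_symm_apply, ENNReal.toReal_mul, toReal_gaussianPDF, smul_eq_mul]
      rw [density, hf p.1 hp.1 (cos p.2, sin p.2),
        show (p.1 * cos p.2) ^ 2 + (p.1 * sin p.2) ^ 2 = p.1 ^ 2 by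
          linear_combination p.1 ^ 2 * sin_sq_add_cos_sq p.2]
      ring
    _ = _ := by
      rw [Measure.volume_eq_prod, setIntegral_prod_mul (fun r : ℝ ↦ r ^ 3 * exp (-(1 / 2) * r ^ 2))
        (fun θ ↦ (2 * π)⁻¹ * f (cos θ, sin θ)), radial, integral_const_mul]
      field_simp

lemma integral_max_cos_mul_max_cos_sub {φ : ℝ} (h0 : 0 ≤ φ) (hπ : φ ≤ π) :
    ∫ θ in -π..π, max (cos θ) 0 * max (cos (θ - φ)) 0 =
      (sin φ + (π - φ) * cos φ) / 2 := by
  have hII (a b : ℝ) :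
      IntervalIntegrable (fun θ ↦ max (cos θ) 0 * max (cos (θ - φ)) 0) volume a b :=
    Continuous.intervalIntegrable (by fun_prop) a b
  have hleft : ∫ θ in -π..(φ - π / 2), max (cos θ) 0 * max (cos (θ - φ)) 0 = 0 := by
    refine intervalIntegral.integral_zero_ae (ae_of_all _ fun θ hθ ↦ ?_)
    rw [Set.uIoc_of_le (by linarith)] at hθ
    rcases le_total θ (-(π / 2)) with h | h
    · rw [max_eq_right (a := cos θ), zero_mul]
      rw [← cos_neg]
      exact cos_nonpos_of_pi_div_two_le_of_le (by linarith) (by linarith [hθ.1])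
    · rw [max_eq_right (a := cos (θ - φ)), mul_zero]
      rw [← cos_neg]
      exact cos_nonpos_of_pi_div_two_le_of_le (by linarith [hθ.2]) (by linarith)
  have hright : ∫ θ in (π / 2)..π, max (cos θ) 0 * max (cos (θ - φ)) 0 = 0 := by
    refine intervalIntegral.integral_zero_ae (ae_of_all _ fun θ hθ ↦ ?_)
    rw [Set.uIoc_of_le (by linarith)] at hθ
    rw [max_eq_right (a := cos θ), zero_mul]
    exact cos_nonpos_of_pi_div_two_le_of_le hθ.1.le (by linarith [hθ.2])
  have hmid : ∫ θ in (φ - π / 2)..(π / 2), max (cos θ) 0 * max (cos (θ - φ)) 0 =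
      (sin φ + (π - φ) * cos φ) / 2 := by
    have hderiv (θ : ℝ) : HasDerivAt (fun θ ↦ cos φ * θ / 2 + sin (2 * θ - φ) / 4)
        (cos θ * cos (θ - φ)) θ := by
      have hsin := (((hasDerivAt_id θ).const_mul 2).sub_const φ).sin.div_const 4
      have hlin := ((hasDerivAt_id θ).const_mul (cos φ)).div_const 2
      refine (hlin.add hsin).congr_deriv ?_
      have hadd := cos_add θ (θ - φ)
      have hsub := cos_sub θ (θ - φ)
      rw [show θ + (θ - φ) = 2 * θ - φ by ring] at hadd
      rw [show θ - (θ - φ) = φ by ring] at hsub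
      simp only [id_eq]
      linear_combination hadd / 2 + hsub / 2
    calc
      _ = ∫ θ in (φ - π / 2)..(π / 2), cos θ * cos (θ - φ) := by
        refine intervalIntegral.integral_congr fun θ hθ ↦ ?_
        rw [Set.uIcc_of_le (by linarith)] at hθ
        rw [max_eq_left (cos_nonneg_of_neg_pi_div_two_le_of_le (by linarith [hθ.1]) hθ.2),
          max_eq_left (cos_nonneg_of_neg_pi_div_two_le_of_le (by linarith [hθ.1])
            (by linarith [hθ.2]))]
      _ = _ := by
        rw [intervalIntegral.integral_eq_sub_of_hasDerivAt (fun θ _ ↦ hderiv θ)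
          (Continuous.intervalIntegrable (by fun_prop) _ _),
          show 2 * (π / 2) - φ = π - φ by ring,
          show 2 * (φ - π / 2) - φ = -(π - φ) by ring, sin_neg, sin_pi_sub]
        ring
  rw [← intervalIntegral.integral_add_adjacent_intervals (hII (-π) (φ - π / 2)) (hII _ π),
    ← intervalIntegral.integral_add_adjacent_intervals (hII (φ - π / 2) (π / 2)) (hII _ π),
    hleft, hmid, hright]
  ring

/-- Arc-cosine kernel of degree 1 for ReLU: let X and Z be independent standard Gaussian
random variables, let σ > 0 and ρ ∈ [−1, 1], and set U₁ = σ·X and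
U₂ = σ·(ρ·X + √(1−ρ²)·Z), so that (U₁, U₂) is a centered bivariate Gaussian pair with common
variance σ² and correlation ρ. Then E[ReLU(U₁)·ReLU(U₂)]
= (σ²/(2π))·(√(1−ρ²) + (π − arccos ρ)·ρ). -/
theorem relu_arccos_kernel
    {Ω : Type*} [MeasurableSpace Ω] (P : Measure Ω) [IsProbabilityMeasure P]
    (X Z : Ω → ℝ)
    (hX : Measure.map X P = gaussianReal 0 1)
    (hZ : Measure.map Z P = gaussianReal 0 1)
    (hXZ : IndepFun X Z P)
    (σ ρ : ℝ) (hσ : 0 < σ) (hρ : ρ ∈ Set.Icc (-1 : ℝ) 1) :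
    ∫ ω, max (σ * X ω) 0 *
        max (σ * (ρ * X ω + Real.sqrt (1 - ρ ^ 2) * Z ω)) 0 ∂P =
      σ ^ 2 / (2 * Real.pi) *
        (Real.sqrt (1 - ρ ^ 2) + (Real.pi - Real.arccos ρ) * ρ) := by
  have hXm : AEMeasurable X P := aemeasurable_of_map_neZero (by rw [hX]; infer_instance)
  have hZm : AEMeasurable Z P := aemeasurable_of_map_neZero (by rw [hZ]; infer_instance)
  have hmap := (indepFun_iff_map_prod_eq_prod_map_map hXm hZm).1 hXZ
  rw [hX, hZ] at hmap
  let f : ℝ × ℝ → ℝ := fun p ↦ max (σ * p.1) 0 * max (σ * (ρ * p.1 + √(1 - ρ ^ 2) * p.2)) 0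
  have hf : Continuous f := by fun_prop
  have hhom (r : ℝ) (hr : 0 < r) (p : ℝ × ℝ) : f (r * p.1, r * p.2) = r ^ 2 * f p := by
    have hmax (a : ℝ) : max (r * a) 0 = r * max a 0 := by
      rw [mul_max_of_nonneg _ _ hr.le, mul_zero]
    simp only [f]
    rw [show σ * (r * p.1) = r * (σ * p.1) by ring,
      show σ * (ρ * (r * p.1) + √(1 - ρ ^ 2) * (r * p.2)) =
        r * (σ * (ρ * p.1 + √(1 - ρ ^ 2) * p.2)) by ring, hmax, hmax]
    ring
  have hcircle (θ : ℝ) : f (cos θ, sin θ) =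
      σ ^ 2 * (max (cos θ) 0 * max (cos (θ - arccos ρ)) 0) := by
    have hmax (a : ℝ) : max (σ * a) 0 = σ * max a 0 := by
      rw [mul_max_of_nonneg _ _ hσ.le, mul_zero]
    simp only [f]
    rw [hmax, hmax, cos_sub, cos_arccos hρ.1 hρ.2, sin_arccos, mul_comm ρ, mul_comm √_]
    ring
  calc
    _ = ∫ p, f p ∂(P.map fun ω ↦ (X ω, Z ω)) :=
      (integral_map (hXm.prodMk hZm) hf.aestronglyMeasurable).symm
    _ = _ := by
      rw [hmap, integral_prod_gaussianReal_of_homogeneous f hhom]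
      simp only [hcircle]
      rw [intervalIntegral.integral_const_mul,
        integral_max_cos_mul_max_cos_sub (arccos_nonneg ρ) (arccos_le_pi ρ),
        cos_arccos hρ.1 hρ.2, sin_arccos]
      field_simp
end

section
/- Let g : ℝ → ℝ be defined by g(ρ) = (1/π)·(√(1−ρ²) + (π − arccos ρ)·ρ). Then g(0) = 1/π, g(1) = 1, and for every ρ ∈ [0, 1) one has ρ < g(ρ) ≤ 1. -/
open Real

/-- The strict inequality `θ cos θ < sin θ`, including at the endpoint `π / 2`. -/
theorem mul_cos_lt_sin_of_le_pi_div_two {θ : ℝ} (h0 : 0 < θ) (h1 : θ ≤ π / 2) :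
    θ * cos θ < sin θ := by
  rcases h1.lt_or_eq with h | rfl
  · have hc : 0 < cos θ := cos_pos_of_mem_Ioo ⟨by linarith, h⟩
    have ht := lt_tan h0 h
    rwa [tan_eq_sin_div_cos, lt_div_iff₀ hc] at ht
  · simp

/-- Let g(ρ) = (1/π)·(√(1−ρ²) + (π − arccos ρ)·ρ). Then g(0) = 1/π, g(1) = 1, and for every
ρ ∈ [0, 1) one has ρ < g(ρ) ≤ 1. -/
theorem relu_recurrence_basic_properties
    (g : ℝ → ℝ)
    (hg : ∀ ρ : ℝ, g ρ =
      (1 / Real.pi) * (Real.sqrt (1 - ρ ^ 2) + (Real.pi - Real.arccos ρ) * ρ)) :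
    g 0 = 1 / Real.pi ∧ g 1 = 1 ∧
      ∀ ρ ∈ Set.Ico (0 : ℝ) 1, ρ < g ρ ∧ g ρ ≤ 1 := by
  refine ⟨by simp [hg], by simp [hg, pi_ne_zero], ?_⟩
  rintro ρ ⟨h0, h1⟩
  have hpos : 0 < arccos ρ := arccos_pos.2 h1
  have hcos : cos (arccos ρ) = ρ := cos_arccos (by linarith) h1.le
  have hlow := mul_cos_lt_sin_of_le_pi_div_two hpos (arccos_le_pi_div_two.2 h0)
  have hup := sin_le hpos.le
  have hpi := arccos_le_pi ρ
  rw [hcos, sin_arccos] at hlow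
  rw [sin_arccos] at hup
  rw [hg, one_div_mul_eq_div, lt_div_iff₀ pi_pos, div_le_one pi_pos]
  constructor
  · linarith
  · nlinarith [mul_nonneg (sub_nonneg.2 hpi) (sub_nonneg.2 h1.le)]
end

section
/- Let g : ℝ → ℝ be defined by g(ρ) = (1/π)·(√(1−ρ²) + (π − arccos ρ)·ρ). Then g is strictly increasing on the interval [0, 1]: for all 0 ≤ ρ₁ < ρ₂ ≤ 1, g(ρ₁) < g(ρ₂). -/
open Real

/-- On `(-1, 1)` the derivative of `√(1 - x²) + (π - arccos x) x` is `π - arccos x`. -/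
theorem hasDerivAt_sqrt_add_pi_sub_arccos_mul {x : ℝ} (h₁ : -1 < x) (h₂ : x < 1) :
    HasDerivAt (fun y : ℝ => √(1 - y ^ 2) + (π - arccos y) * y) (π - arccos x) x := by
  have hpos : 0 < 1 - x ^ 2 := by nlinarith
  have hs : √(1 - x ^ 2) ≠ 0 := (Real.sqrt_pos.2 hpos).ne'
  have hsqrt := ((hasDerivAt_pow 2 x).const_sub 1).sqrt hpos.ne'
  have hmul := ((hasDerivAt_arccos h₁.ne' h₂.ne).const_sub π).mul (hasDerivAt_id' x)
  refine (hsqrt.add hmul).congr_deriv ?_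
  field_simp
  ring

/-- The map `√(1 - x²) + (π - arccos x) x` is strictly increasing on `[-1, 1]`. -/
theorem strictMonoOn_sqrt_add_pi_sub_arccos_mul :
    StrictMonoOn (fun y : ℝ => √(1 - y ^ 2) + (π - arccos y) * y) (Set.Icc (-1) 1) := by
  refine strictMonoOn_of_deriv_pos (convex_Icc _ _) ?_ fun x hx => ?_
  · have := continuous_arccos
    fun_prop
  · rw [interior_Icc] at hx
    rw [(hasDerivAt_sqrt_add_pi_sub_arccos_mul hx.1 hx.2).deriv, arccos]
    linarith [neg_pi_div_two_lt_arcsin.2 hx.1]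

/-- Let g(ρ) = (1/π)·(√(1−ρ²) + (π − arccos ρ)·ρ). Then g is strictly increasing on [0, 1]. -/
theorem relu_recurrence_strictMonoOn
    (g : ℝ → ℝ)
    (hg : ∀ ρ : ℝ, g ρ =
      (1 / Real.pi) * (Real.sqrt (1 - ρ ^ 2) + (Real.pi - Real.arccos ρ) * ρ)) :
    ∀ ρ₁ ρ₂ : ℝ, 0 ≤ ρ₁ → ρ₁ < ρ₂ → ρ₂ ≤ 1 → g ρ₁ < g ρ₂ := by
  intro ρ₁ ρ₂ h₁ h₁₂ h₂
  rw [hg, hg]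
  exact mul_lt_mul_of_pos_left
    (strictMonoOn_sqrt_add_pi_sub_arccos_mul ⟨by linarith, by linarith⟩
      ⟨by linarith, h₂⟩ h₁₂) (by positivity)
end

section
/- Let g : ℝ → ℝ be defined by g(ρ) = (1/π)·(√(1−ρ²) + (π − arccos ρ)·ρ). Then for ρ ∈ [0, 1], g(ρ) = ρ if and only if ρ = 1; i.e., 1 is the unique fixed point of g in [0, 1]. -/
open Real

/-- Let g(ρ) = (1/π)·(√(1−ρ²) + (π − arccos ρ)·ρ). Then for ρ ∈ [0, 1], g(ρ) = ρ iff ρ = 1. -/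
theorem relu_recurrence_unique_fixed_point
    (g : ℝ → ℝ)
    (hg : ∀ ρ : ℝ, g ρ =
      (1 / Real.pi) * (Real.sqrt (1 - ρ ^ 2) + (Real.pi - Real.arccos ρ) * ρ)) :
    ∀ ρ ∈ Set.Icc (0 : ℝ) 1, g ρ = ρ ↔ ρ = 1 := by
  rintro ρ ⟨h0, h1⟩
  rw [hg]
  have hpi : Real.pi ≠ 0 := Real.pi_ne_zero
  constructor
  · intro h
    have key : Real.sqrt (1 - ρ ^ 2) = Real.arccos ρ * ρ := by
      field_simp at h
      linarith
    by_contra hne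
    have hlt : ρ < 1 := lt_of_le_of_ne h1 hne
    rcases h0.eq_or_lt with rfl | hpos
    · norm_num at key
    · have ht := Real.lt_tan (Real.arccos_pos.2 hlt) (Real.arccos_lt_pi_div_two.2 hpos)
      rw [Real.tan_arccos, lt_div_iff₀ hpos] at ht
      exact ht.ne' key
  · rintro rfl
    simp [hpi]
end

section
/- Monotone growth of layer-wise correlation under ReLU (Proposition 1, monotonicity): define the sequence (ρ̄ₗ) by ρ̄₀ = 0 and ρ̄ₗ₊₁ = g(ρ̄ₗ), where g(ρ) = (1/π)·(√(1−ρ²) + (π − arccos ρ)·ρ). Then ρ̄₁ = 1/π, the sequence is strictly increasing in l, and ρ̄ₗ ∈ [0, 1) for every l. -/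
open Real

/-- On `[0, 1)`, the inequality `θ cos θ < sin θ` at `θ = arccos x`. -/
lemma arccos_mul_lt_sqrt_one_sub_sq {x : ℝ} (hx0 : 0 ≤ x) (hx1 : x < 1) :
    Real.arccos x * x < Real.sqrt (1 - x ^ 2) := by
  rcases hx0.eq_or_lt with rfl | hpos
  · simp
  · have htan := Real.lt_tan (Real.arccos_pos.2 hx1) (Real.arccos_lt_pi_div_two.2 hpos)
    rwa [Real.tan_arccos, lt_div_iff₀ hpos] at htan

/-- The inequality `sin θ < θ` at `θ = arccos x`. -/
lemma sqrt_one_sub_sq_lt_arccos {x : ℝ} (hx1 : x < 1) :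
    Real.sqrt (1 - x ^ 2) < Real.arccos x := by
  rw [← Real.sin_arccos]
  exact Real.sin_lt (Real.arccos_pos.2 hx1)

/-- Monotone growth of layer-wise correlation under ReLU (Proposition 1, monotonicity):
define ρ̄₀ = 0 and ρ̄ₗ₊₁ = g(ρ̄ₗ) with g(ρ) = (1/π)·(√(1−ρ²) + (π − arccos ρ)·ρ). Then
ρ̄₁ = 1/π, the sequence is strictly increasing, and ρ̄ₗ ∈ [0, 1) for every l. -/
theorem relu_correlation_monotone
    (g : ℝ → ℝ)
    (hg : ∀ ρ : ℝ, g ρ =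
      (1 / Real.pi) * (Real.sqrt (1 - ρ ^ 2) + (Real.pi - Real.arccos ρ) * ρ))
    (r : ℕ → ℝ) (h0 : r 0 = 0) (hrec : ∀ l : ℕ, r (l + 1) = g (r l)) :
    r 1 = 1 / Real.pi ∧ StrictMono r ∧ ∀ l : ℕ, r l ∈ Set.Ico (0 : ℝ) 1 := by
  have lt_g : ∀ x : ℝ, 0 ≤ x → x < 1 → x < g x := by
    intro x hx0 hx1
    rw [hg, one_div_mul_eq_div, lt_div_iff₀ Real.pi_pos]
    linarith [arccos_mul_lt_sqrt_one_sub_sq hx0 hx1]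
  have g_lt_one : ∀ x : ℝ, x < 1 → g x < 1 := by
    intro x hx1
    rw [hg, one_div_mul_eq_div, div_lt_one Real.pi_pos]
    nlinarith [sqrt_one_sub_sq_lt_arccos hx1,
      mul_nonneg (sub_nonneg.2 (Real.arccos_le_pi x)) (sub_nonneg.2 hx1.le)]
  have mem : ∀ l : ℕ, r l ∈ Set.Ico (0 : ℝ) 1 := by
    intro l
    induction l with
    | zero => simp [h0]
    | succ l ih =>
      rw [hrec]
      exact ⟨ih.1.trans (lt_g _ ih.1 ih.2).le, g_lt_one _ ih.2⟩
  refine ⟨?_, strictMono_nat_of_lt_succ fun l => ?_, mem⟩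
  · rw [← zero_add 1, hrec, h0, hg]
    simp
  · rw [hrec]
    exact lt_g _ (mem l).1 (mem l).2
end

section
/- Total collapse of layer-wise correlation under ReLU (Proposition 1, limiting case): define the sequence (ρ̄ₗ) by ρ̄₀ = 0 and ρ̄ₗ₊₁ = g(ρ̄ₗ), where g(ρ) = (1/π)·(√(1−ρ²) + (π − arccos ρ)·ρ). Then ρ̄ₗ converges to 1 as l → ∞. -/
open Real Filter

/-- The tangent inequality `θ < tan θ`, transported along `ρ = cos θ`. -/
theorem arccos_mul_self_lt_sqrt {ρ : ℝ} (h0 : 0 ≤ ρ) (h1 : ρ < 1) :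
    arccos ρ * ρ < √(1 - ρ ^ 2) := by
  rcases h0.eq_or_lt with rfl | hpos
  · simp
  · have h := lt_tan (arccos_pos.2 h1) (arccos_lt_pi_div_two.2 hpos)
    rwa [tan_arccos, lt_div_iff₀ hpos] at h

/-- The inequality `sin θ ≤ θ`, transported along `ρ = cos θ`. -/
theorem sqrt_one_sub_sq_le_arccos (ρ : ℝ) : √(1 - ρ ^ 2) ≤ arccos ρ := by
  rw [← sin_arccos]
  exact sin_le (arccos_nonneg ρ)

/-- Total collapse of layer-wise correlation under ReLU (Proposition 1, limiting case):
define ρ̄₀ = 0 and ρ̄ₗ₊₁ = g(ρ̄ₗ) with g(ρ) = (1/π)·(√(1−ρ²) + (π − arccos ρ)·ρ). Then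
ρ̄ₗ → 1 as l → ∞. -/
theorem relu_correlation_tendsto_one
    (g : ℝ → ℝ)
    (hg : ∀ ρ : ℝ, g ρ =
      (1 / Real.pi) * (Real.sqrt (1 - ρ ^ 2) + (Real.pi - Real.arccos ρ) * ρ))
    (r : ℕ → ℝ) (h0 : r 0 = 0) (hrec : ∀ l : ℕ, r (l + 1) = g (r l)) :
    Tendsto r atTop (nhds 1) := by
  have hcont : Continuous g := by
    rw [funext hg]
    fun_prop
  have hg_eq (ρ : ℝ) : g ρ = ρ + (√(1 - ρ ^ 2) - arccos ρ * ρ) / π := by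
    rw [hg]
    field_simp
    ring
  have hlt {ρ : ℝ} (hρ : 0 ≤ ρ) (hρ' : ρ < 1) : ρ < g ρ := by
    rw [hg_eq]
    have := div_pos (sub_pos.2 (arccos_mul_self_lt_sqrt hρ hρ')) pi_pos
    linarith
  have hle {ρ : ℝ} (hρ : 0 ≤ ρ) (hρ' : ρ ≤ 1) : ρ ≤ g ρ := by
    rcases hρ'.eq_or_lt with rfl | h
    · simp [hg_eq]
    · exact (hlt hρ h).le
  have hg_le {ρ : ℝ} (hρ' : ρ ≤ 1) : g ρ ≤ 1 := by
    rw [hg, one_div, inv_mul_le_iff₀ pi_pos, mul_one]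
    have := mul_le_mul_of_nonneg_left hρ' (sub_nonneg.2 (arccos_le_pi ρ))
    linarith [sqrt_one_sub_sq_le_arccos ρ]
  have hmem (l : ℕ) : 0 ≤ r l ∧ r l ≤ 1 := by
    induction l with
    | zero => simp [h0]
    | succ l ih =>
      rw [hrec]
      exact ⟨ih.1.trans (hle ih.1 ih.2), hg_le ih.2⟩
  have hmono : Monotone r := monotone_nat_of_le_succ fun l ↦ by
    rw [hrec]
    exact hle (hmem l).1 (hmem l).2
  have hlim := tendsto_atTop_ciSup hmono ⟨1, Set.forall_mem_range.2 fun l ↦ (hmem l).2⟩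
  set L := ⨆ l, r l
  have hfix : g L = L := by
    refine tendsto_nhds_unique ((hcont.tendsto L).comp hlim) ?_
    simpa only [Function.comp_def, ← hrec] using (tendsto_add_atTop_iff_nat 1).2 hlim
  have hL0 : 0 ≤ L := ge_of_tendsto' hlim fun l ↦ (hmem l).1
  have hL1 : L ≤ 1 := le_of_tendsto' hlim fun l ↦ (hmem l).2
  have hL : L = 1 := hL1.eq_of_not_lt fun h ↦ (hlt hL0 h).ne' hfix
  rwa [hL] at hlim
end

section
/- Cosine similarity of uniformly correlated averages: let H be a real inner product space, let T ≥ 1, let ρ ∈ [0, 1), and let v₁, …, v_T and w₁, …, w_T be vectors in H satisfying ‖vᵢ‖² = ‖wⱼ‖² = 1 for all i, j, ⟨vᵢ, vⱼ⟩ = ρ and ⟨wᵢ, wⱼ⟩ = ρ for all i ≠ j, and ⟨vᵢ, wⱼ⟩ = ρ for all i, j. Set y = (1/T)·Σᵢ vᵢ and y' = (1/T)·Σⱼ wⱼ. Then ‖y‖² = ‖y'‖² = (1 + (T−1)ρ)/T > 0, ⟨y, y'⟩ = ρ, and the cosine similarity ⟨y, y'⟩/(‖y‖·‖y'‖) equals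 T·ρ/(T·ρ + 1 − ρ). -/
open RealInnerProductSpace Finset

/-- The squared norm of the average of unit vectors with common pairwise inner product `ρ`. -/
theorem norm_sq_average_of_inner_eq
    {H : Type*} [NormedAddCommGroup H] [InnerProductSpace ℝ H]
    {T : ℕ} (hT : T ≠ 0) {ρ : ℝ} {v : Fin T → H}
    (hnorm : ∀ i, ‖v i‖ ^ 2 = 1) (hinner : ∀ i j, i ≠ j → ⟪v i, v j⟫ = ρ) :
    ‖((1 : ℝ) / T) • ∑ i, v i‖ ^ 2 = (1 + (T - 1 : ℝ) * ρ) / T := by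
  have hT' : (T : ℝ) ≠ 0 := Nat.cast_ne_zero.mpr hT
  have h (i j : Fin T) : ⟪v i, v j⟫ = ρ + if i = j then 1 - ρ else 0 := by
    split_ifs with hij
    · rw [hij, real_inner_self_eq_norm_sq, hnorm]
      ring
    · rw [hinner i j hij, add_zero]
  rw [← real_inner_self_eq_norm_sq, real_inner_smul_left, real_inner_smul_right, sum_inner]
  simp only [inner_sum, h, sum_add_distrib, sum_const, sum_ite_eq, mem_univ, if_true,
    card_univ, Fintype.card_fin, nsmul_eq_mul]
  field_simp
  ring

/-- The inner product of two averages whose terms have common cross inner product `ρ`. -/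
theorem inner_average_of_inner_eq
    {H : Type*} [NormedAddCommGroup H] [InnerProductSpace ℝ H]
    {T : ℕ} (hT : T ≠ 0) {ρ : ℝ} {v w : Fin T → H} (hinner : ∀ i j, ⟪v i, w j⟫ = ρ) :
    ⟪((1 : ℝ) / T) • ∑ i, v i, ((1 : ℝ) / T) • ∑ j, w j⟫ = ρ := by
  have hT' : (T : ℝ) ≠ 0 := Nat.cast_ne_zero.mpr hT
  rw [real_inner_smul_left, real_inner_smul_right, sum_inner]
  simp only [inner_sum, hinner, sum_const, card_univ, Fintype.card_fin, nsmul_eq_mul]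
  field_simp

/-- Cosine similarity of uniformly correlated averages: if v₁,…,v_T and w₁,…,w_T are unit-norm
vectors in a real inner product space with all distinct pairwise inner products equal to
ρ ∈ [0,1) (within each family and across families), then the averages
y = (1/T)·Σ vᵢ and y' = (1/T)·Σ wⱼ satisfy ‖y‖² = ‖y'‖² = (1+(T−1)ρ)/T > 0, ⟨y,y'⟩ = ρ,
and ⟨y,y'⟩/(‖y‖·‖y'‖) = T·ρ/(T·ρ + 1 − ρ). -/
theorem cosine_similarity_of_uniformly_correlated_averages
    {H : Type*} [NormedAddCommGroup H] [InnerProductSpace ℝ H]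
    (T : ℕ) (hT : 1 ≤ T) (ρ : ℝ) (hρ : ρ ∈ Set.Ico (0 : ℝ) 1)
    (v w : Fin T → H)
    (hv_norm : ∀ i, ‖v i‖ ^ 2 = 1) (hw_norm : ∀ j, ‖w j‖ ^ 2 = 1)
    (hvv : ∀ i j, i ≠ j → ⟪v i, v j⟫ = ρ)
    (hww : ∀ i j, i ≠ j → ⟪w i, w j⟫ = ρ)
    (hvw : ∀ i j, ⟪v i, w j⟫ = ρ)
    (y y' : H)
    (hy : y = ((1 : ℝ) / T) • ∑ i, v i)
    (hy' : y' = ((1 : ℝ) / T) • ∑ j, w j) :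
    ‖y‖ ^ 2 = (1 + (T - 1 : ℝ) * ρ) / T ∧
    ‖y'‖ ^ 2 = (1 + (T - 1 : ℝ) * ρ) / T ∧
    (0 : ℝ) < (1 + (T - 1 : ℝ) * ρ) / T ∧
    ⟪y, y'⟫ = ρ ∧
    ⟪y, y'⟫ / (‖y‖ * ‖y'‖) = T * ρ / (T * ρ + 1 - ρ) := by
  have hT0 : T ≠ 0 := Nat.one_le_iff_ne_zero.mp hT
  have hTpos : (0 : ℝ) < T := Nat.cast_pos.mpr hT
  have hT1 : (1 : ℝ) ≤ T := Nat.one_le_cast.mpr hT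
  have hnum : 0 < 1 + (T - 1 : ℝ) * ρ := by
    have := mul_nonneg (sub_nonneg.mpr hT1) hρ.1
    linarith
  have h1 : ‖y‖ ^ 2 = (1 + (T - 1 : ℝ) * ρ) / T :=
    hy ▸ norm_sq_average_of_inner_eq hT0 hv_norm hvv
  have h2 : ‖y'‖ ^ 2 = (1 + (T - 1 : ℝ) * ρ) / T :=
    hy' ▸ norm_sq_average_of_inner_eq hT0 hw_norm hww
  have h3 : ⟪y, y'⟫ = ρ := by
    rw [hy, hy']
    exact inner_average_of_inner_eq hT0 hvw
  refine ⟨h1, h2, div_pos hnum hTpos, h3, ?_⟩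
  have heq : ‖y'‖ = ‖y‖ :=
    (sq_eq_sq₀ (norm_nonneg _) (norm_nonneg _)).mp (h2.trans h1.symm)
  rw [h3, heq, ← sq, h1, div_div_eq_mul_div, mul_comm ρ]
  congr 1
  ring
end

section
/- Attention amplifies contraction more than a second MLP layer (Proposition 2, comparison): for every integer T ≥ 3, T/(T + π − 1) > g(1/π), where g(ρ) = (1/π)·(√(1−ρ²) + (π − arccos ρ)·ρ). -/
open Real

/-- Attention amplifies contraction more than a second MLP layer (Proposition 2, comparison):
for every integer T ≥ 3, T/(T + π − 1) > g(1/π), where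
g(ρ) = (1/π)·(√(1−ρ²) + (π − arccos ρ)·ρ). -/
theorem attn_beats_second_mlp
    (g : ℝ → ℝ)
    (hg : ∀ ρ : ℝ, g ρ =
      (1 / Real.pi) * (Real.sqrt (1 - ρ ^ 2) + (Real.pi - Real.arccos ρ) * ρ))
    (T : ℕ) (hT : 3 ≤ T) :
    (T : ℝ) / ((T : ℝ) + Real.pi - 1) > g (1 / Real.pi) := by
  have hπ : 3 < π := pi_gt_three
  have hρ : 1 / π ≤ 1 / 2 := one_div_le_one_div_of_le two_pos (by linarith)
  have harcsin : arcsin (1 / π) ≤ π / 6 := by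
    rw [arcsin_le_iff_le_sin' ⟨by linarith, by linarith⟩, sin_pi_div_six]
    exact hρ
  have hsqrt : √(1 - (1 / π) ^ 2) ≤ 1 :=
    sqrt_le_one.mpr (sub_le_self 1 (sq_nonneg _))
  have hangle : (π - arccos (1 / π)) * (1 / π) ≤ 2 / 3 := by
    rw [mul_one_div, div_le_iff₀ pi_pos, arccos_eq_pi_div_two_sub_arcsin]
    linarith
  have hT' : (3 : ℝ) ≤ T := by exact_mod_cast hT
  calc g (1 / π) ≤ 1 / π * (5 / 3) := by
        rw [hg]
        gcongr
        linarith
    _ < T / (T + π - 1) := by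
        rw [one_div_mul_eq_div, div_lt_div_iff₀ pi_pos (by linarith)]
        nlinarith
end

section
/- Deep-layer limit of the intra-sequence similarity closed form (Proposition 3): for integers L ≥ 2, define S(L) = ((L−2)! / (2L−4)!) · Σ_{k=0}^{L−2} ((L−2+k)!/k!) · (2/3)^{L−1−k}. Then S(L) converges to 1 as L → ∞. -/
open Real Filter Finset

/-- For fixed `j`, the ratio of the falling factorials of `n` and `2 * n` tends to `2⁻ʲ`. -/
theorem tendsto_descFactorial_div_descFactorial_two_mul (j : ℕ) :
    Tendsto (fun n : ℕ => (n.descFactorial j : ℝ) / ((2 * n).descFactorial j : ℝ)) atTop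
      (nhds ((1 / 2 : ℝ) ^ j)) := by
  induction j with
  | zero => simp
  | succ j ih =>
    have h : Tendsto (fun n : ℕ => ((n : ℝ) - j) / (2 * n - j)) atTop (nhds (1 / 2)) := by
      have h0 := tendsto_const_div_atTop_nhds_zero_nat (j : ℝ)
      have h1 : Tendsto (fun n : ℕ => (1 - (j : ℝ) / n) / (2 - (j : ℝ) / n)) atTop
          (nhds ((1 - 0) / (2 - 0))) :=
        (tendsto_const_nhds.sub h0).div (tendsto_const_nhds.sub h0) (by norm_num)
      rw [sub_zero, sub_zero] at h1
      refine h1.congr' ?_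
      filter_upwards [eventually_gt_atTop 0] with n hn
      have hn' : (n : ℝ) ≠ 0 := by positivity
      rw [← mul_div_mul_right _ _ hn', sub_mul, sub_mul, div_mul_cancel₀ _ hn', one_mul]
    rw [pow_succ']
    refine (h.mul ih).congr' ?_
    filter_upwards [eventually_ge_atTop j] with n hn
    rw [Nat.descFactorial_succ, Nat.descFactorial_succ, Nat.cast_mul, Nat.cast_mul,
      Nat.cast_sub hn, Nat.cast_sub (by lia : j ≤ 2 * n), mul_div_mul_comm]
    push_cast
    rfl

theorem tendsto_tsum_descFactorial_div_descFactorial_two_mul :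
    Tendsto (fun n : ℕ => ∑' j : ℕ,
      (n.descFactorial j : ℝ) / ((2 * n).descFactorial j : ℝ) * (2 / 3) ^ (j + 1)) atTop
      (nhds 1) := by
  have hsum : ∑' j : ℕ, (1 / 2 : ℝ) ^ j * (2 / 3) ^ (j + 1) = 1 := by
    have h : ∀ j : ℕ, (1 / 2 : ℝ) ^ j * (2 / 3) ^ (j + 1) = (1 / 3) ^ j * (2 / 3) := fun j => by
      rw [pow_succ, ← mul_assoc, ← mul_pow]
      norm_num
    simp_rw [h]
    rw [tsum_mul_right, tsum_geometric_of_lt_one (by norm_num) (by norm_num)]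
    norm_num
  rw [← hsum]
  refine tendsto_tsum_of_dominated_convergence (bound := fun j : ℕ => (2 / 3 : ℝ) ^ (j + 1)) ?_
    (fun j => (tendsto_descFactorial_div_descFactorial_two_mul j).mul_const _) ?_
  · exact (summable_nat_add_iff 1).2 (summable_geometric_of_lt_one (by norm_num) (by norm_num))
  · refine Eventually.of_forall fun n j => ?_
    rw [Real.norm_of_nonneg (by positivity)]
    refine mul_le_of_le_one_left (by positivity) (div_le_one_of_le₀ ?_ (by positivity))
    exact_mod_cast Nat.descFactorial_le j (by lia : n ≤ 2 * n)

theorem factorial_div_mul_sum_eq_tsum_descFactorial (n : ℕ) (x : ℝ) :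
    ((n.factorial : ℝ) / ((2 * n).factorial : ℝ)) *
        ∑ k ∈ range (n + 1), (((n + k).factorial : ℝ) / (k.factorial : ℝ)) * x ^ (n + 1 - k) =
      ∑' j : ℕ, (n.descFactorial j : ℝ) / ((2 * n).descFactorial j : ℝ) * x ^ (j + 1) := by
  rw [tsum_eq_sum (s := range (n + 1)), mul_sum, ← Finset.sum_flip]
  · refine sum_congr rfl fun j hj => ?_
    have hj : j ≤ n := by simpa [Nat.lt_succ_iff] using hj
    have h1 : (((n - j).factorial : ℕ) : ℝ) * n.descFactorial j = n.factorial := by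
      exact_mod_cast Nat.factorial_mul_descFactorial hj
    have h2 : (((2 * n - j).factorial : ℕ) : ℝ) * (2 * n).descFactorial j
        = (2 * n).factorial := by
      exact_mod_cast Nat.factorial_mul_descFactorial (by lia : j ≤ 2 * n)
    have h3 : ((2 * n).descFactorial j : ℝ) ≠ 0 := by
      exact_mod_cast (Nat.descFactorial_pos.2 (by lia : j ≤ 2 * n)).ne'
    rw [show n + (n - j) = 2 * n - j by lia, show n + 1 - (n - j) = j + 1 by lia, ← h1, ← h2]
    field_simp
  · intro j hj
    have hj : n < j := by simpa [Nat.lt_succ_iff] using hj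
    simp [Nat.descFactorial_of_lt hj]

/-- Deep-layer limit of the intra-sequence similarity closed form (Proposition 3): for
integers L ≥ 2, define S(L) = ((L−2)! / (2L−4)!) · Σ_{k=0}^{L−2} ((L−2+k)!/k!) · (2/3)^{L−1−k}.
Then S(L) → 1 as L → ∞. -/
theorem intra_sequence_similarity_tendsto_one
    (S : ℕ → ℝ)
    (hS : ∀ L : ℕ, 2 ≤ L → S L =
      ((Nat.factorial (L - 2) : ℝ) / (Nat.factorial (2 * L - 4) : ℝ)) *
        ∑ k ∈ Finset.range (L - 1),
          ((Nat.factorial (L - 2 + k) : ℝ) / (Nat.factorial k : ℝ)) *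
            ((2 : ℝ) / 3) ^ (L - 1 - k)) :
    Tendsto S atTop (nhds 1) := by
  rw [← tendsto_add_atTop_iff_nat 2]
  refine tendsto_tsum_descFactorial_div_descFactorial_two_mul.congr fun n => ?_
  rw [hS (n + 2) (by lia), ← factorial_div_mul_sum_eq_tsum_descFactorial,
    show n + 2 - 2 = n by lia, show 2 * (n + 2) - 4 = 2 * n by lia, show n + 2 - 1 = n + 1 by lia]
end
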